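/- Suppose the sequence A is uniform exponentially bounded (there exist M > 0 and α ∈ ℝ with ‖A(m,n)‖ ≤ M e^{α(m−n)} for all m ≥ n) and that 0 does not belong to the approximate point spectrum of G on c00 (equivalently, there is θ > 0 with ‖u‖_∞ ≤ θ‖Gu‖_∞ for all u ∈ c00). If sup_{m≥n} ‖A(m,n)x₀‖ < ∞ for some fixed n ∈ ℕ and x₀ ∈ E, then there exist constants N, ν > 0, independent of n and x₀, such that ‖A(m,n)x₀‖ ≤ N e^{−ν(m−n)} ‖x₀‖ for all m ≥ n. -/

import Mathlib

open Filter Topology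

variable {E : Type*} [NormedAddCommGroup E] [NormedSpace ℝ E] [CompleteSpace E]

/-- `evol A n m` is the evolution operator `A(m,n) = A_{m-1} ∘ ⋯ ∘ A_n`
(the identity if `m ≤ n`). -/
def evol (A : ℕ → E →L[ℝ] E) (n : ℕ) : ℕ → E →L[ℝ] E
  | 0 => 1
  | m + 1 => if n ≤ m then A m * evol A n m else 1

/-- `α` is an admissible exponent for `A`: there is a positive sequence `M` with
`‖A(m,n)‖ ≤ M n * e^{α (m - n)}` for all `m ≥ n`. -/
def IsAdmissible (A : ℕ → E →L[ℝ] E) (α : ℝ) : Prop :=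
  ∃ M : ℕ → ℝ, (∀ n, 0 < M n) ∧
    ∀ m n : ℕ, n ≤ m → ‖evol A n m‖ ≤ M n * Real.exp (α * ((m : ℝ) - (n : ℝ)))

/-- The norm `‖x‖_{n,α} = sup_{m ≥ n} e^{-α(m-n)} ‖A(m,n) x‖`. -/
noncomputable def nnorm (A : ℕ → E →L[ℝ] E) (α : ℝ) (n : ℕ) (x : E) : ℝ :=
  ⨆ m : Set.Ici n, Real.exp (-α * (((m : ℕ) : ℝ) - (n : ℝ))) * ‖evol A n (m : ℕ) x‖

/-- Membership in `c00(α)`: `u 0 = 0` and `‖u n‖_{n,α} → 0`. -/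
def MemC00 (A : ℕ → E →L[ℝ] E) (α : ℝ) (u : ℕ → E) : Prop :=
  u 0 = 0 ∧ Tendsto (fun n => nnorm A α n (u n)) atTop (𝓝 0)

/-- The norm `‖u‖_α = sup_n ‖u n‖_{n,α}` on `c00(α)`. -/
noncomputable def cnorm (A : ℕ → E →L[ℝ] E) (α : ℝ) (u : ℕ → E) : ℝ :=
  ⨆ n, nnorm A α n (u n)

/-- The evolution map `T`: `(Tu)_0 = 0`, `(Tu)_{n+1} = A_n u_n`. -/
def Tmap (A : ℕ → E →L[ℝ] E) (u : ℕ → E) : ℕ → E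
  | 0 => 0
  | m + 1 => A m (u m)

/-- `G = T - Id`. -/
def Gmap (A : ℕ → E →L[ℝ] E) (u : ℕ → E) : ℕ → E :=
  fun n => Tmap A u n - u n

/-- Membership in `c00` (with the original norm of `E`). -/
def MemC00u (u : ℕ → E) : Prop :=
  u 0 = 0 ∧ Tendsto (fun n => ‖u n‖) atTop (𝓝 0)

/-- The sup norm `‖u‖_∞ = sup_n ‖u n‖`. -/
noncomputable def supNorm (u : ℕ → E) : ℝ := ⨆ n, ‖u n‖

set_option linter.unusedSectionVars false

theorem evol_self (A : ℕ → E →L[ℝ] E) (n : ℕ) : evol A n n = 1 := by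
  cases n <;> simp [evol]

theorem evol_succ (A : ℕ → E →L[ℝ] E) {n m : ℕ} (h : n ≤ m) :
    evol A n (m + 1) = A m * evol A n m := by
  simp [evol, h]

theorem evol_eq_evol_succ_mul (A : ℕ → E →L[ℝ] E) {n m : ℕ} (h : n + 1 ≤ m) :
    evol A n m = evol A (n + 1) m * A n := by
  induction m, h using Nat.le_induction with
  | base => simp [evol_succ, evol_self]
  | succ k hk ih => rw [evol_succ A (by omega), evol_succ A hk, ih, mul_assoc]

/-- The two-sided geometric weight `q ^ |j - L|`, centred at `L`. -/
def tentWeight (q : ℝ) (L j : ℕ) : ℝ := q ^ ((j - L) + (L - j))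

theorem tentWeight_nonneg {q : ℝ} (hq : 0 ≤ q) (L j : ℕ) : 0 ≤ tentWeight q L j :=
  pow_nonneg hq _

theorem abs_tentWeight_sub_succ_le {q δ : ℝ} (hq : 0 < q) (hq1 : q < 1) (hδ : 1 - q = δ * q)
    (L j : ℕ) :
    |tentWeight q L j - tentWeight q L (j + 1)| ≤ δ * tentWeight q L (j + 1) := by
  unfold tentWeight
  have hδ0 : 0 < δ := by
    by_contra! h
    nlinarith
  rcases lt_or_ge j L with h | h
  · obtain ⟨a, rfl⟩ := Nat.exists_eq_add_of_lt h
    have e1 : (j - (j + a + 1)) + ((j + a + 1) - j) = a + 1 := by omega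
    have e2 : (j + 1 - (j + a + 1)) + ((j + a + 1) - (j + 1)) = a := by omega
    rw [e1, e2]
    have hp := pow_pos hq a
    have : q ^ (a + 1) - q ^ a = -(q ^ a * (1 - q)) := by ring
    rw [this, abs_neg, abs_of_nonneg (by nlinarith), mul_comm]
    gcongr
    nlinarith
  · obtain ⟨b, rfl⟩ := Nat.exists_eq_add_of_le h
    have e1 : (L + b - L) + (L - (L + b)) = b := by omega
    have e2 : (L + b + 1 - L) + (L - (L + b + 1)) = b + 1 := by omega
    rw [e1, e2]
    have hp := pow_pos hq b
    have : q ^ b - q ^ (b + 1) = q ^ b * (1 - q) := by ring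
    rw [this, abs_of_nonneg (by nlinarith), hδ]
    apply le_of_eq
    ring

/-- The orbit of `x` started at time `n`, multiplied by the weight centred at time `n + L`. -/
def weightedOrbit (A : ℕ → E →L[ℝ] E) (q : ℝ) (L n : ℕ) (x : E) (k : ℕ) : E :=
  if n ≤ k then tentWeight q L (k - n) • evol A n k x else 0

theorem memC00u_weightedOrbit (A : ℕ → E →L[ℝ] E) {q : ℝ} (hq : 0 < q) (hq1 : q < 1) (L : ℕ)
    {n : ℕ} (hn : 1 ≤ n) {x : E}
    (hb : BddAbove (Set.range fun m : Set.Ici n => ‖evol A n (m : ℕ) x‖)) :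
    MemC00u (weightedOrbit A q L n x) := by
  obtain ⟨K, hK⟩ := hb
  have hK' : ∀ k, n ≤ k → ‖evol A n k x‖ ≤ K := fun k hk => hK ⟨⟨k, hk⟩, rfl⟩
  have hK0 : 0 ≤ K := (norm_nonneg _).trans (hK' n le_rfl)
  refine ⟨by simp [weightedOrbit, show ¬ n ≤ 0 by omega], ?_⟩
  have hlim : Tendsto (fun k : ℕ => q ^ (k - (n + L)) * K) atTop (𝓝 0) := by
    simpa using ((tendsto_pow_atTop_nhds_zero_of_lt_one hq.le hq1).comp
      (tendsto_sub_atTop_nat (n + L))).mul_const K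
  refine squeeze_zero (fun _ => norm_nonneg _) (fun k => ?_) hlim
  by_cases hk : n ≤ k
  · rw [weightedOrbit, if_pos hk, norm_smul, Real.norm_of_nonneg (tentWeight_nonneg hq.le _ _)]
    gcongr
    · exact pow_le_pow_of_le_one hq.le hq1.le (by omega)
    · exact hK' k hk
  · rw [weightedOrbit, if_neg hk, norm_zero]
    positivity

theorem norm_Gmap_weightedOrbit_le (A : ℕ → E →L[ℝ] E) {q δ : ℝ} (hq : 0 < q) (hq1 : q < 1)
    (hδ : 1 - q = δ * q) (L : ℕ) {n : ℕ} (hn : 1 ≤ n) (x : E) (k : ℕ) :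
    ‖Gmap A (weightedOrbit A q L n x) k‖ ≤
      max (q ^ L * ‖x‖) (δ * ‖weightedOrbit A q L n x k‖) := by
  rcases lt_trichotomy k n with h | rfl | h
  · refine le_max_of_le_left ?_
    have : Gmap A (weightedOrbit A q L n x) k = 0 := by
      cases k with
      | zero => simp [Gmap, Tmap, weightedOrbit, show n ≠ 0 by omega]
      | succ m =>
        simp [Gmap, Tmap, weightedOrbit, show ¬ n ≤ m by omega, show ¬ n ≤ m + 1 by omega]
    rw [this, norm_zero]
    positivity
  · refine le_max_of_le_left ?_
    obtain ⟨m, rfl⟩ := Nat.exists_eq_add_of_le' hn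
    simp [Gmap, Tmap, weightedOrbit, evol_self, tentWeight, norm_smul, abs_of_pos hq]
  · refine le_max_of_le_right ?_
    obtain ⟨j, rfl⟩ := Nat.exists_eq_add_of_lt h
    have e : Gmap A (weightedOrbit A q L n x) (n + j + 1) =
        (tentWeight q L j - tentWeight q L (j + 1)) • evol A n (n + j + 1) x := by
      have h1 : n + j + 1 - n = j + 1 := by omega
      have h2 : n ≤ n + j + 1 := by omega
      simp [Gmap, Tmap, weightedOrbit, h1, h2, evol_succ, sub_smul]
    have e' : weightedOrbit A q L n x (n + j + 1) =
        tentWeight q L (j + 1) • evol A n (n + j + 1) x := by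
      have h1 : n + j + 1 - n = j + 1 := by omega
      have h2 : n ≤ n + j + 1 := by omega
      simp [weightedOrbit, h1, h2]
    rw [e, e', norm_smul, norm_smul, Real.norm_of_nonneg (tentWeight_nonneg hq.le _ _),
      ← mul_assoc, Real.norm_eq_abs]
    gcongr
    exact abs_tentWeight_sub_succ_le hq hq1 hδ L j

theorem norm_evol_le_of_bddAbove (A : ℕ → E →L[ℝ] E) {θ q δ : ℝ} (hθ : 0 < θ)
    (hbelow : ∀ u : ℕ → E, MemC00u u → supNorm u ≤ θ * supNorm (Gmap A u))
    (hq : 0 < q) (hq1 : q < 1) (hδ : 1 - q = δ * q) (hθδ : θ * δ < 1) {n : ℕ} (hn : 1 ≤ n)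
    {x : E} (hb : BddAbove (Set.range fun m : Set.Ici n => ‖evol A n (m : ℕ) x‖)) (L : ℕ) :
    ‖evol A n (n + L) x‖ ≤ θ * q ^ L * ‖x‖ := by
  set w := weightedOrbit A q L n x with hw
  have hmem : MemC00u w := memC00u_weightedOrbit A hq hq1 L hn hb
  have hle : ∀ k, ‖w k‖ ≤ supNorm w := fun k => le_ciSup hmem.2.bddAbove_range k
  have hδ0 : 0 < δ := by
    by_contra! h
    nlinarith
  have hS0 : 0 ≤ supNorm w := (norm_nonneg _).trans (hle 0)
  have hG : supNorm (Gmap A w) ≤ max (q ^ L * ‖x‖) (δ * supNorm w) := by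
    refine ciSup_le fun k => (norm_Gmap_weightedOrbit_le A hq hq1 hδ L hn x k).trans ?_
    gcongr
    exact hle k
  have hS : supNorm w ≤ θ * q ^ L * ‖x‖ := by
    have h1 := (hbelow w hmem).trans (mul_le_mul_of_nonneg_left hG hθ.le)
    rcases max_cases (q ^ L * ‖x‖) (δ * supNorm w) with ⟨h, _⟩ | ⟨h, _⟩
    · rw [h] at h1
      linarith
    · rw [h] at h1
      have h2 : supNorm w ≤ 0 := by
        by_contra! h3
        nlinarith
      exact h2.trans (by positivity)
  have hwL : w (n + L) = evol A n (n + L) x := by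
    simp [hw, weightedOrbit, tentWeight]
  rw [← hwL]
  exact (hle _).trans hS

/-- If `A` is uniform exponentially bounded and `0 ∉ σ_ap(G)` on `c00`
(i.e. `‖u‖_∞ ≤ θ ‖G u‖_∞` for some `θ > 0`), then there are constants `N, ν > 0`,
independent of `n` and `x₀`, such that every bounded orbit satisfies
`‖A(m,n) x₀‖ ≤ N e^{-ν(m-n)} ‖x₀‖` for all `m ≥ n`. -/
theorem stmt15 (A : ℕ → E →L[ℝ] E) (M α : ℝ) (hM : 0 < M)
    (hbd : ∀ m n : ℕ, n ≤ m → ‖evol A n m‖ ≤ M * Real.exp (α * ((m : ℝ) - (n : ℝ))))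
    (θ : ℝ) (hθ : 0 < θ)
    (hbelow : ∀ u : ℕ → E, MemC00u u → supNorm u ≤ θ * supNorm (Gmap A u)) :
    ∃ N : ℝ, 0 < N ∧ ∃ ν : ℝ, 0 < ν ∧
      ∀ (n : ℕ) (x₀ : E),
        BddAbove (Set.range fun m : Set.Ici n => ‖evol A n (m : ℕ) x₀‖) →
        ∀ m : ℕ, n ≤ m →
          ‖evol A n m x₀‖ ≤ N * Real.exp (-ν * ((m : ℝ) - (n : ℝ))) * ‖x₀‖ := by
  obtain ⟨q, hq⟩ : ∃ q : ℝ, q = (1 + 1 / (2 * θ))⁻¹ := ⟨_, rfl⟩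
  have hr : 1 < 1 + 1 / (2 * θ) := by
    have : 0 < 1 / (2 * θ) := by positivity
    linarith
  have hq0 : 0 < q := by
    rw [hq]
    positivity
  have hq1 : q < 1 := hq ▸ inv_lt_one_of_one_lt₀ hr
  have hδ : 1 - q = 1 / (2 * θ) * q := by
    have : (1 + 1 / (2 * θ)) * q = 1 := by
      rw [hq]
      exact mul_inv_cancel₀ (by positivity)
    linarith
  have hθδ : θ * (1 / (2 * θ)) < 1 := by
    field_simp
    norm_num
  have hexp : ∀ j : ℕ, Real.exp (-(-Real.log q) * j) = q ^ j := fun j => by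
    rw [neg_neg, mul_comm, Real.exp_nat_mul, Real.exp_log hq0]
  have key := fun {n : ℕ} (hn : 1 ≤ n) {x : E} hb L =>
    norm_evol_le_of_bddAbove A (x := x) hθ hbelow hq0 hq1 hδ hθδ hn hb L
  have hA : ‖A 0‖ ≤ M * Real.exp α := by
    simpa [evol] using hbd 1 0 zero_le_one
  have hNθ : 0 < θ * q⁻¹ * (M * Real.exp α) := by positivity
  refine ⟨1 + θ + θ * q⁻¹ * (M * Real.exp α), by positivity, -Real.log q,
    neg_pos.2 (Real.log_neg hq0 hq1), fun n x₀ hb m hm => ?_⟩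
  obtain ⟨L, rfl⟩ := Nat.exists_eq_add_of_le hm
  rw [show ((n + L : ℕ) : ℝ) - n = L by push_cast; ring, hexp]
  rcases Nat.eq_zero_or_pos n with rfl | hn
  · cases L with
    | zero =>
      simp only [add_zero, evol_self, pow_zero, mul_one, one_apply_eq_self]
      exact le_mul_of_one_le_left (norm_nonneg _) (by linarith)
    | succ L =>
      have hsplit : ∀ k, 1 ≤ k → evol A 0 k x₀ = evol A 1 k (A 0 x₀) := fun k hk => by
        rw [evol_eq_evol_succ_mul A (n := 0) hk]
        rfl
      have hb1 : BddAbove (Set.range fun m : Set.Ici 1 => ‖evol A 1 (m : ℕ) (A 0 x₀)‖) := by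
        refine hb.mono ?_
        rintro _ ⟨⟨k, hk⟩, rfl⟩
        exact ⟨⟨k, Nat.zero_le k⟩, congrArg norm (hsplit k hk)⟩
      have h1 := key le_rfl hb1 L
      rw [zero_add, hsplit _ (by omega), add_comm L 1]
      calc ‖evol A 1 (1 + L) (A 0 x₀)‖ ≤ θ * q ^ L * ‖A 0 x₀‖ := h1
        _ ≤ θ * q ^ L * (M * Real.exp α * ‖x₀‖) := by
          gcongr
          exact (A 0).le_of_opNorm_le hA x₀
        _ = θ * q⁻¹ * (M * Real.exp α) * q ^ (1 + L) * ‖x₀‖ := by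
          rw [pow_add]
          field_simp
        _ ≤ _ := by
          gcongr
          linarith
  · refine (key hn hb L).trans ?_
    gcongr
    linarith
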